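/- arXiv:1811.08387 — 10 statements merged into one kernel-verified Lean document; each statement's English description precedes it below -/
import Mathlib

section
/- Let n ≥ 2 be an integer. Every vector v ∈ ℝⁿ can be written as v = ((v(1)+v(2))/2)·v₁ⁿ + ∑_{i=2}^{n−1} ((v(i+1)−v(i))/2)·vᵢⁿ + ((v(1)−v(n))/2)·vₙⁿ. In particular, the set 𝓑ₙ = {v₁ⁿ, …, vₙⁿ} is a basis of ℝⁿ. -/
open scoped BigOperators

noncomputable section

def vvec (n : ℕ) (i : Fin n) : Fin n → ℝ :=
  fun j => if 0 < (j : ℕ) ∧ (j : ℕ) ≤ (i : ℕ) then -1 else 1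

def MSet (Y : Type*) [NormedAddCommGroup Y] [NormedSpace ℝ Y] (n : ℕ) :
    Set (Fin n → Y) :=
  {y | ∀ k : ℕ, Odd k → k ≤ n → ∀ c : Fin k → Fin n, StrictMono c →
    ‖∑ j : Fin k, ((-1 : ℝ) ^ (j : ℕ)) • y (c j)‖ ≤ 1}

def AHSpWith (Y : Type*) [NormedAddCommGroup Y] [NormedSpace ℝ Y] (n : ℕ)
    (γ : ℝ → ℝ) : Prop :=
  ∀ ε : ℝ, 0 < ε → ε < 1 →
    (0 < γ ε ∧ γ ε < ε) ∧
    ∀ y ∈ MSet Y n, ∀ A : Finset (Fin n), A.Nonempty →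
      ∀ f : Y →L[ℝ] ℝ, ‖f‖ = 1 → (∀ i ∈ A, 1 - γ ε < f (y i)) →
        ∃ z ∈ MSet Y n, (∀ i, ‖z i - y i‖ < ε) ∧ ‖∑ i ∈ A, z i‖ = (A.card : ℝ)

def AHSp (Y : Type*) [NormedAddCommGroup Y] [NormedSpace ℝ Y] (n : ℕ) : Prop :=
  ∀ ε : ℝ, 0 < ε → ε < 1 → ∃ γ : ℝ, 0 < γ ∧ γ < ε ∧
    ∀ y ∈ MSet Y n, ∀ A : Finset (Fin n), A.Nonempty →
      ∀ f : Y →L[ℝ] ℝ, ‖f‖ = 1 → (∀ i ∈ A, 1 - γ < f (y i)) →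
        ∃ z ∈ MSet Y n, (∀ i, ‖z i - y i‖ < ε) ∧ ‖∑ i ∈ A, z i‖ = (A.card : ℝ)

def BPBpWith (X Y : Type*) [NormedAddCommGroup X] [NormedSpace ℝ X]
    [NormedAddCommGroup Y] [NormedSpace ℝ Y] (η : ℝ → ℝ) : Prop :=
  ∀ ε : ℝ, 0 < ε → ε < 1 →
    (0 < η ε ∧ η ε < ε) ∧
    ∀ T : X →L[ℝ] Y, ‖T‖ = 1 → ∀ x₀ : X, ‖x₀‖ = 1 → 1 - η ε < ‖T x₀‖ →
      ∃ S : X →L[ℝ] Y, ‖S‖ = 1 ∧ ∃ u₀ : X, ‖u₀‖ = 1 ∧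
        ‖S u₀‖ = 1 ∧ ‖u₀ - x₀‖ < ε ∧ ‖S - T‖ < ε

def IsOneNorming {Y : Type*} [NormedAddCommGroup Y] [NormedSpace ℝ Y]
    (B : Set (Y →L[ℝ] ℝ)) : Prop :=
  (∀ f ∈ B, ‖f‖ = 1) ∧ ∀ y : Y, ‖y‖ = sSup ((fun f : Y →L[ℝ] ℝ => |f y|) '' B)

def tauMap (Y : Type*) [Neg Y] (n : ℕ) (y : Fin n → Y) : Fin n → Y :=
  fun i => if h : (i : ℕ) + 1 < n then y ⟨(i : ℕ) + 1, h⟩ else -y ⟨0, i.pos⟩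

def ustar (x : lp (fun _ : ℕ => ℝ) 1) : ℝ := ∑' k, x k

/-- Partial sums of the decomposition, for a sequence `w` on `ℕ`. -/
lemma sum_range_signed_differences (w : ℕ → ℝ) (j k : ℕ) :
    ∑ i ∈ Finset.range (k + 1),
        (if i = 0 then (w 0 + w 1) / 2 else (w (i + 1) - w i) / 2) *
          (if 0 < j ∧ j ≤ i then -1 else 1) =
      if 0 < j ∧ j ≤ k then w j + (w 0 - w (k + 1)) / 2 else (w 0 + w (k + 1)) / 2 := by
  induction k with
  | zero =>
    have h : ¬ (0 < j ∧ j ≤ 0) := by omega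
    simp only [zero_add, Finset.sum_range_one, if_neg h, if_true, mul_one]
  | succ k ih =>
    rw [Finset.sum_range_succ, ih, if_neg k.succ_ne_zero]
    by_cases h : 0 < j ∧ j ≤ k
    · rw [if_pos h, if_pos (by omega), if_pos (by omega)]
      ring
    · rw [if_neg h]
      by_cases h' : 0 < j ∧ j ≤ k + 1
      · obtain rfl : j = k + 1 := by omega
        rw [if_pos h', if_pos h']
        ring
      · rw [if_neg h', if_neg h']
        ring

lemma eq_sum_smul_vvec (n : ℕ) (h₀ : 0 < n) (h₁ : 1 < n) (hlast : n - 1 < n)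
    (v : Fin n → ℝ) :
    v = ∑ i : Fin n,
        (if (i : ℕ) = 0 then (v ⟨0, h₀⟩ + v ⟨1, h₁⟩) / 2
         else if (i : ℕ) = n - 1 then (v ⟨0, h₀⟩ - v ⟨n - 1, hlast⟩) / 2
         else (v (i + ⟨1, h₁⟩) - v i) / 2) • vvec n i := by
  obtain ⟨m, rfl⟩ : ∃ m, n = m + 1 := ⟨n - 1, by omega⟩
  set w : ℕ → ℝ := fun k => if h : k < m + 1 then v ⟨k, h⟩ else v ⟨0, by omega⟩ with hw
  have hwlt (k : ℕ) (h : k < m + 1) : w k = v ⟨k, h⟩ := by simp only [hw, dif_pos h]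
  have hwlast : w (m + 1) = v ⟨0, by omega⟩ := by simp [hw]
  ext j
  have key := sum_range_signed_differences w j m
  rw [← Fin.sum_univ_eq_sum_range (fun i =>
    (if i = 0 then (w 0 + w 1) / 2 else (w (i + 1) - w i) / 2) *
      (if 0 < (j : ℕ) ∧ (j : ℕ) ≤ i then -1 else 1))] at key
  have hval : v j = if 0 < (j : ℕ) ∧ (j : ℕ) ≤ m then w j + (w 0 - w (m + 1)) / 2
      else (w 0 + w (m + 1)) / 2 := by
    rw [hwlast, hwlt 0 (by omega), hwlt j j.isLt]
    split_ifs with h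
    · simp
    · obtain rfl : j = ⟨0, by omega⟩ := Fin.ext (by have := j.isLt; simp only; omega)
      ring
  rw [hval, ← key, Finset.sum_apply]
  refine Finset.sum_congr rfl fun i _ => ?_
  rw [Pi.smul_apply, smul_eq_mul, vvec]
  congr 1
  by_cases h0 : (i : ℕ) = 0
  · rw [if_pos h0, if_pos h0, hwlt 0 (by omega), hwlt 1 (by omega)]
  rw [if_neg h0, if_neg h0, hwlt i i.isLt]
  by_cases h1 : (i : ℕ) = m + 1 - 1
  · have hi : i = ⟨m + 1 - 1, by omega⟩ := Fin.ext h1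
    rw [if_pos h1, show (i : ℕ) + 1 = m + 1 by omega, hwlast, ← hi]
  · have hlt : (i : ℕ) + 1 < m + 1 := by have := i.isLt; omega
    have hi : i + ⟨1, by omega⟩ = ⟨(i : ℕ) + 1, hlt⟩ :=
      Fin.ext (by simp [Fin.val_add, Nat.mod_eq_of_lt hlt])
    rw [if_neg h1, hwlt _ hlt, hi]

lemma span_range_vvec (n : ℕ) (hn : 2 ≤ n) :
    Submodule.span ℝ (Set.range (vvec n)) = ⊤ := by
  refine eq_top_iff.2 fun v _ => ?_
  rw [eq_sum_smul_vvec n (by omega) (by omega) (by omega) v]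
  exact Submodule.sum_mem _ fun i _ =>
    Submodule.smul_mem _ _ (Submodule.subset_span (Set.mem_range_self i))

/-- decomposition of any `v : ℝⁿ` in the basis `𝓑ₙ = {v₁ⁿ,…,vₙⁿ}` (0-indexed:
`vvec n i` is `v_{i+1}ⁿ`), and `𝓑ₙ` is a basis of `ℝⁿ`. -/
theorem stmt0 (n : ℕ) (hn : 2 ≤ n) (v : Fin n → ℝ) :
    v = ∑ i : Fin n,
        (if (i : ℕ) = 0 then (v ⟨0, by omega⟩ + v ⟨1, by omega⟩) / 2
         else if (i : ℕ) = n - 1 then (v ⟨0, by omega⟩ - v ⟨n - 1, by omega⟩) / 2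
         else (v (i + ⟨1, by omega⟩) - v i) / 2) • vvec n i
    ∧ LinearIndependent ℝ (vvec n)
    ∧ Submodule.span ℝ (Set.range (vvec n)) = ⊤ := by
  exact ⟨eq_sum_smul_vvec n _ _ _ v,
    linearIndependent_of_top_le_span_of_card_eq_finrank (span_range_vvec n hn).ge (by simp),
    span_range_vvec n hn⟩
end
end

section
/- For each positive integer n, the convex hull of 𝓑ₙ equals Oₙ, i.e. co(𝓑ₙ) = {v ∈ ℓ∞ⁿ : v(1) = ‖v‖ = 1 and v(i) ≤ v(i+1) for all 2 ≤ i < n}. -/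
open scoped BigOperators

noncomputable section

theorem norm_eq_one_iff_forall_abs_le {n : ℕ} {v : Fin n → ℝ} {i₀ : Fin n} (h : v i₀ = 1) :
    ‖v‖ = 1 ↔ ∀ i, |v i| ≤ 1 := by
  constructor
  · intro hv i
    simpa [hv] using norm_le_pi_norm v i
  · intro hv
    refine le_antisymm ((pi_norm_le_iff_of_nonneg zero_le_one).2 hv) ?_
    simpa [h] using norm_le_pi_norm v i₀

theorem sum_range_half_sub_mul_sign (a : ℕ → ℝ) (j m : ℕ) :
    ∑ i ∈ Finset.range m, (a (i + 1) - a i) / 2 * (if j ≤ i then -1 else 1) =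
      if m ≤ j then (a m - a 0) / 2 else (2 * a j - a 0 - a m) / 2 := by
  induction m with
  | zero => simp
  | succ m ih =>
    rw [Finset.sum_range_succ, ih]
    rcases lt_trichotomy m j with h | rfl | h
    · rw [if_pos h.le, if_neg (by omega), if_pos (by omega)]
      ring
    · simp only [le_refl, if_true, if_neg (show ¬ m + 1 ≤ m by omega)]
      ring
    · rw [if_neg (by omega), if_pos h.le, if_neg (by omega)]
      ring

/-- The coordinates of `v` with the first replaced by `-1`, followed by the constant `1`. -/
def paddedCoord {n : ℕ} (v : Fin n → ℝ) (j : ℕ) : ℝ :=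
  if j = 0 then -1 else if h : j < n then v ⟨j, h⟩ else 1

theorem paddedCoord_zero {n : ℕ} (v : Fin n → ℝ) : paddedCoord v 0 = -1 := rfl

theorem paddedCoord_self {n : ℕ} (hn : 0 < n) (v : Fin n → ℝ) : paddedCoord v n = 1 := by
  simp [paddedCoord, hn.ne']

theorem paddedCoord_le_succ {n : ℕ} {v : Fin n → ℝ} (hb : ∀ i, |v i| ≤ 1)
    (hm : ∀ i : Fin n, 1 ≤ (i : ℕ) → ∀ h2 : (i : ℕ) + 1 < n, v i ≤ v ⟨(i : ℕ) + 1, h2⟩)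
    (j : ℕ) : paddedCoord v j ≤ paddedCoord v (j + 1) := by
  simp only [paddedCoord, Nat.add_one_ne_zero, if_false]
  split_ifs with h0 h1 h1 h2 h2
  · exact (abs_le.1 (hb _)).1
  · norm_num
  · exact hm ⟨j, h1⟩ (Nat.one_le_iff_ne_zero.2 h0) h2
  · exact (abs_le.1 (hb _)).2
  · omega
  · exact le_rfl

theorem sum_paddedCoord_smul_vvec {n : ℕ} (hn : 0 < n) {v : Fin n → ℝ} (h0 : v ⟨0, hn⟩ = 1) :
    ∑ i : Fin n, ((paddedCoord v (i + 1) - paddedCoord v i) / 2) • vvec n i = v := by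
  ext j
  simp only [Finset.sum_apply, Pi.smul_apply, smul_eq_mul, vvec]
  rcases Nat.eq_zero_or_pos (j : ℕ) with hj | hj
  · obtain rfl : j = ⟨0, hn⟩ := Fin.ext hj
    simp only [lt_irrefl, false_and, if_false, mul_one]
    rw [Fin.sum_univ_eq_sum_range
      (fun i => (paddedCoord v (i + 1) - paddedCoord v i) / 2), ← Finset.sum_div,
      Finset.sum_range_sub, paddedCoord_self hn, paddedCoord_zero, h0]
    norm_num
  · simp only [hj, true_and]
    rw [Fin.sum_univ_eq_sum_range
      (fun i => (paddedCoord v (i + 1) - paddedCoord v i) / 2 * (if (j : ℕ) ≤ i then -1 else 1)),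
      sum_range_half_sub_mul_sign, if_neg (by omega), paddedCoord_self hn, paddedCoord_zero]
    simp [paddedCoord, hj.ne']

/-- `co(𝓑ₙ) = Oₙ` (0-indexed: coordinate `0` is the paper's coordinate `1`,
and the monotonicity condition `v(i) ≤ v(i+1)` for `2 ≤ i < n` becomes
`v j ≤ v (j+1)` for `1 ≤ j`, `j + 1 < n`). -/
theorem stmt1 (n : ℕ) (hn : 0 < n) :
    convexHull ℝ (Set.range (vvec n)) =
      {v : Fin n → ℝ | v ⟨0, hn⟩ = 1 ∧ ‖v‖ = 1 ∧
        ∀ i : Fin n, ∀ _h1 : 1 ≤ (i : ℕ), ∀ h2 : (i : ℕ) + 1 < n,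
          v i ≤ v ⟨(i : ℕ) + 1, h2⟩} := by
  apply Set.Subset.antisymm
  · refine convexHull_min ?_ ?_
    · rintro _ ⟨i, rfl⟩
      have h0 : vvec n i ⟨0, hn⟩ = 1 := by simp [vvec]
      refine ⟨h0, (norm_eq_one_iff_forall_abs_le h0).2 fun j => ?_, fun j h1 h2 => ?_⟩
      · unfold vvec
        split_ifs <;> simp
      · simp only [vvec]
        split_ifs <;> first | omega | norm_num
    · rintro x ⟨hx0, hx, hxm⟩ y ⟨hy0, hy, hym⟩ a b ha hb hab
      have h0 : (a • x + b • y) ⟨0, hn⟩ = 1 := by simp [hx0, hy0, hab]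
      rw [norm_eq_one_iff_forall_abs_le hx0] at hx
      rw [norm_eq_one_iff_forall_abs_le hy0] at hy
      refine ⟨h0, (norm_eq_one_iff_forall_abs_le h0).2 fun j => ?_, fun j h1 h2 => ?_⟩
      · have hxj := abs_le.1 (hx j)
        have hyj := abs_le.1 (hy j)
        simp only [Pi.add_apply, Pi.smul_apply, smul_eq_mul]
        rw [abs_le]
        constructor <;> nlinarith
      · simp only [Pi.add_apply, Pi.smul_apply, smul_eq_mul]
        exact add_le_add (mul_le_mul_of_nonneg_left (hxm j h1 h2) ha)
          (mul_le_mul_of_nonneg_left (hym j h1 h2) hb)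
  · rintro v ⟨h0, hv, hm⟩
    rw [norm_eq_one_iff_forall_abs_le h0] at hv
    rw [← sum_paddedCoord_smul_vvec hn h0]
    refine (convex_convexHull ℝ _).sum_mem (fun i _ => ?_) ?_
      fun i _ => subset_convexHull ℝ _ ⟨i, rfl⟩
    · exact div_nonneg (sub_nonneg.2 (paddedCoord_le_succ hv hm i)) zero_le_two
    · rw [Fin.sum_univ_eq_sum_range
        (fun i => (paddedCoord v (i + 1) - paddedCoord v i) / 2), ← Finset.sum_div,
        Finset.sum_range_sub, paddedCoord_self hn, paddedCoord_zero]
      norm_num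
end
end

section
/- For each positive integer n, the set of extreme points of E₁ⁿ equals { ∑_{j=1}^{k} (−1)^{j+1} v_{i_j}ⁿ : (i₁, …, i_k) ∈ 𝓘ₙ }. -/
open scoped BigOperators

noncomputable section

theorem face_eq_pi (n : ℕ) (hn : 0 < n) :
    {v : Fin n → ℝ | v ⟨0, hn⟩ = 1 ∧ ‖v‖ = 1} =
      Set.univ.pi fun j : Fin n => Set.Icc (if (j : ℕ) = 0 then (1 : ℝ) else -1) 1 := by
  ext v
  simp only [Set.mem_ofPred_eq, Set.mem_univ_pi, Set.mem_Icc]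
  constructor
  · rintro ⟨h0, hv⟩ j
    have hj : |v j| ≤ 1 := by simpa [hv] using norm_le_pi_norm v j
    refine ⟨?_, (abs_le.1 hj).2⟩
    split_ifs with h
    · rw [show j = ⟨0, hn⟩ from Fin.ext h, h0]
    · exact (abs_le.1 hj).1
  · intro h
    have h0 : v ⟨0, hn⟩ = 1 := le_antisymm (h _).2 (by simpa using (h ⟨0, hn⟩).1)
    refine ⟨h0, le_antisymm ?_ ?_⟩
    · refine (pi_norm_le_iff_of_nonneg zero_le_one).2 fun j => abs_le.2 ⟨?_, (h j).2⟩
      have := (h j).1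
      split_ifs at this <;> linarith
    · simpa [h0] using norm_le_pi_norm v ⟨0, hn⟩

theorem mem_extremePoints_face_iff (n : ℕ) (hn : 0 < n) (x : Fin n → ℝ) :
    x ∈ Set.extremePoints ℝ {v : Fin n → ℝ | v ⟨0, hn⟩ = 1 ∧ ‖v‖ = 1} ↔
      x ⟨0, hn⟩ = 1 ∧ ∀ j, x j = 1 ∨ x j = -1 := by
  rw [face_eq_pi, extremePoints_pi, Set.mem_univ_pi]
  have key : ∀ j : Fin n,
      Set.extremePoints ℝ (Set.Icc (if (j : ℕ) = 0 then (1 : ℝ) else -1) 1) =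
        {if (j : ℕ) = 0 then (1 : ℝ) else -1, 1} := fun j =>
    Set.extremePoints_Icc (by split_ifs <;> norm_num)
  simp only [key, Set.mem_insert_iff, Set.mem_singleton_iff]
  constructor
  · intro h
    refine ⟨by simpa using h ⟨0, hn⟩, fun j => ?_⟩
    have := h j
    split_ifs at this <;> tauto
  · rintro ⟨h0, h⟩ j
    split_ifs with hj
    · rw [show j = ⟨0, hn⟩ from Fin.ext hj, h0]
      simp
    · exact (h j).symm

/-- The alternating sum of an antitone sequence of signs is determined by its product. -/
theorem alternating_sum_of_antitone_signs (k : ℕ) (a : Fin k → ℝ) (ha : Antitone a)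
    (hs : ∀ t, a t = 1 ∨ a t = -1) :
    (Odd k → ∑ t : Fin k, (-1 : ℝ) ^ (t : ℕ) * a t = ∏ t, a t) ∧
      (Even k → ∑ t : Fin k, (-1 : ℝ) ^ (t : ℕ) * a t = 1 - ∏ t, a t) := by
  induction k with
  | zero => simp
  | succ k ih =>
    obtain ⟨hodd, heven⟩ := ih (fun t => a t.castSucc)
      (fun s t hst => ha (Fin.castSucc_le_castSucc_iff.2 hst)) (fun t => hs _)
    have hprod : a (Fin.last k) = 1 → ∏ t : Fin k, a t.castSucc = 1 := fun h =>
      Finset.prod_eq_one fun t _ => by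
        have := ha (Fin.le_last t.castSucc)
        rcases hs t.castSucc with h' | h' <;> linarith
    simp only [Fin.sum_univ_castSucc, Fin.prod_univ_castSucc, Fin.val_castSucc, Fin.val_last]
    constructor
    · intro hk
      have hk' : Even k := by simpa [Nat.odd_add_one] using hk
      rw [heven hk', hk'.neg_one_pow]
      rcases hs (Fin.last k) with h | h
      · rw [h, hprod h]; ring
      · rw [h]; ring
    · intro hk
      have hk' : Odd k := by simpa [Nat.even_add_one] using hk
      rw [hodd hk', hk'.neg_one_pow]
      rcases hs (Fin.last k) with h | h
      · rw [h, hprod h]; ring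
      · rw [h]; ring

theorem vvec_eq_one_or_neg_one (n : ℕ) (i j : Fin n) : vvec n i j = 1 ∨ vvec n i j = -1 := by
  unfold vvec
  split_ifs <;> simp

theorem vvec_antitone (n : ℕ) (j : Fin n) : Antitone fun i => vvec n i j := by
  intro i i' hi
  have hi' : (i : ℕ) ≤ i' := hi
  simp only [vvec]
  split_ifs <;> first | omega | norm_num

theorem alternating_sum_vvec_eq_prod (n k : ℕ) (hk : Odd k) (c : Fin k → Fin n)
    (hc : StrictMono c) :
    ∑ t : Fin k, ((-1 : ℝ) ^ (t : ℕ)) • vvec n (c t) = fun j => ∏ t, vvec n (c t) j := by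
  ext j
  simpa [Finset.sum_apply] using (alternating_sum_of_antitone_signs k (fun t => vvec n (c t) j)
    ((vvec_antitone n j).comp_monotone hc.monotone)
    fun t => vvec_eq_one_or_neg_one n (c t) j).1 hk

theorem prod_Ico_mul_succ_of_signs (w : ℕ → ℝ) (hw : ∀ i, w i = 1 ∨ w i = -1) {j n : ℕ}
    (hjn : j ≤ n) : ∏ i ∈ Finset.Ico j n, w i * w (i + 1) = w j * w n := by
  have hsq : ∀ i, w i * w i = 1 := fun i => by rcases hw i with h | h <;> simp [h]
  induction n, hjn using Nat.le_induction with
  | base => simp [hsq]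
  | succ n hn ih =>
    rw [Finset.prod_Ico_succ_top hn, ih]
    linear_combination w j * w (n + 1) * hsq n

/-- Every sign vector with first entry `1` is a product of an odd number of the `vvec n i`. -/
theorem exists_odd_card_prod_vvec_eq (n : ℕ) (hn : 0 < n) (x : Fin n → ℝ)
    (h0 : x ⟨0, hn⟩ = 1) (hx : ∀ j, x j = 1 ∨ x j = -1) :
    ∃ S : Finset (Fin n), Odd S.card ∧ ∀ j, ∏ i ∈ S, vvec n i j = x j := by
  let w : ℕ → ℝ := fun i => if i = 0 then -1 else if h : i < n then x ⟨i, h⟩ else 1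
  have hw : ∀ i, w i = 1 ∨ w i = -1 := by
    intro i
    simp only [w]
    split_ifs with h1 h2
    · simp
    · exact hx _
    · simp
  have hwn : w n = 1 := by simp [w, hn.ne']
  have hq : ∀ i, w i * w (i + 1) = 1 ∨ w i * w (i + 1) = -1 := by
    intro i
    rcases hw i with h | h <;> rcases hw (i + 1) with h' | h' <;> simp [h, h']
  let S : Finset (Fin n) := {i | w i * w (i + 1) = -1}
  have hprod : ∀ j ≤ n, ∏ i ∈ S, (if j ≤ (i : ℕ) then (-1 : ℝ) else 1) = w j := by
    intro j hj
    calc ∏ i ∈ S, (if j ≤ (i : ℕ) then (-1 : ℝ) else 1)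
        = ∏ i : Fin n, if j ≤ (i : ℕ) then w i * w (i + 1) else 1 := by
          rw [Finset.prod_filter]
          refine Finset.prod_congr rfl fun i _ => ?_
          rcases hq i with h | h
          · rw [h]; norm_num
          · simp [h]
      _ = ∏ i ∈ Finset.range n, if j ≤ i then w i * w (i + 1) else 1 :=
          Fin.prod_univ_eq_prod_range (fun i => if j ≤ i then w i * w (i + 1) else 1) n
      _ = ∏ i ∈ Finset.Ico j n, w i * w (i + 1) := by
          rw [← Finset.prod_filter]
          congr 1
          ext i
          simp [and_comm]
      _ = w j := by rw [prod_Ico_mul_succ_of_signs w hw hj, hwn, mul_one]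
  refine ⟨S, ?_, fun j => ?_⟩
  · have h := hprod 0 hn.le
    simp only [Nat.zero_le, if_true, Finset.prod_const] at h
    rw [show w 0 = -1 from rfl] at h
    exact (neg_one_pow_eq_neg_one_iff_odd (by norm_num)).1 h
  · by_cases hj : (j : ℕ) = 0
    · rw [show j = ⟨0, hn⟩ from Fin.ext hj, h0]
      exact Finset.prod_eq_one fun i _ => by simp [vvec]
    · have h := hprod j j.2.le
      rw [show w j = x j by simp [w, hj]] at h
      simpa [vvec, Nat.pos_of_ne_zero hj] using h

/-- the extreme points of `E₁ⁿ = {v : v(1) = ‖v‖ = 1}` are exactly the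
alternating sums `∑_{j=1}^k (−1)^{j+1} v_{i_j}ⁿ` over strictly increasing odd-length tuples
(0-indexed: strictly monotone `c : Fin k → Fin n`, `k` odd, `k ≤ n`). -/
theorem stmt2 (n : ℕ) (hn : 0 < n) :
    Set.extremePoints ℝ {v : Fin n → ℝ | v ⟨0, hn⟩ = 1 ∧ ‖v‖ = 1} =
      {x : Fin n → ℝ | ∃ k : ℕ, Odd k ∧ k ≤ n ∧ ∃ c : Fin k → Fin n, StrictMono c ∧
        x = ∑ j : Fin k, ((-1 : ℝ) ^ (j : ℕ)) • vvec n (c j)} := by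
  ext x
  rw [mem_extremePoints_face_iff, Set.mem_ofPred_eq]
  constructor
  · rintro ⟨h0, hx⟩
    obtain ⟨S, hS, hprod⟩ := exists_odd_card_prod_vvec_eq n hn x h0 hx
    refine ⟨S.card, hS, by simpa using S.card_le_univ, S.orderEmbOfFin rfl,
      (S.orderEmbOfFin rfl).strictMono, ?_⟩
    rw [alternating_sum_vvec_eq_prod n _ hS _ (S.orderEmbOfFin rfl).strictMono]
    ext j
    have hmap := Finset.prod_map Finset.univ (S.orderEmbOfFin rfl).toEmbedding
      fun i => vvec n i j
    rw [Finset.map_orderEmbOfFin_univ] at hmap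
    rw [← hprod j, hmap]
    rfl
  · rintro ⟨k, hk, -, c, hc, rfl⟩
    rw [alternating_sum_vvec_eq_prod n k hk c hc]
    refine ⟨Finset.prod_eq_one fun t _ => by simp [vvec], fun j => ?_⟩
    refine Finset.prod_induction _ (fun r : ℝ => r = 1 ∨ r = -1) ?_ (Or.inl rfl)
      fun t _ => vvec_eq_one_or_neg_one n (c t) j
    rintro a b (rfl | rfl) (rfl | rfl) <;> simp
end
end

section
/- Let Y be a real Banach space, n a positive integer, (y₁,…,yₙ) ∈ Yⁿ, and m a positive integer. Then (y₁,…,yₙ) ∈ M_Yⁿ if and only if τₙᵐ((y₁,…,yₙ)) ∈ M_Yⁿ, where τₙ : Yⁿ → Yⁿ is the map τₙ(y₁,…,yₙ) = (y₂, …, yₙ, −y₁) and τₙᵐ denotes its m-fold iterate. -/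
open scoped BigOperators

noncomputable section

lemma neg_mem_MSet {Y : Type*} [NormedAddCommGroup Y] [NormedSpace ℝ Y] {n : ℕ}
    {y : Fin n → Y} (hy : y ∈ MSet Y n) : -y ∈ MSet Y n := by
  intro k hk hkn c hc
  simpa only [Pi.neg_apply, smul_neg, Finset.sum_neg_distrib, norm_neg] using hy k hk hkn c hc

lemma tauMap_mem_MSet {Y : Type*} [NormedAddCommGroup Y] [NormedSpace ℝ Y] {n : ℕ}
    {y : Fin n → Y} (hy : y ∈ MSet Y n) : tauMap Y n y ∈ MSet Y n := by
  intro k hk hkn c hc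
  obtain ⟨l, rfl⟩ : ∃ l, k = l + 1 := ⟨k - 1, by have := hk.pos; omega⟩
  by_cases h : (c (Fin.last l) : ℕ) + 1 < n
  · have hlt (j : Fin (l + 1)) : (c j : ℕ) + 1 < n :=
      lt_of_le_of_lt (Nat.succ_le_succ (hc.monotone (Fin.le_last j))) h
    have hmono : StrictMono fun j => (⟨c j + 1, hlt j⟩ : Fin n) :=
      fun a b hab => Nat.succ_lt_succ (hc hab)
    simpa only [tauMap, hlt, dite_true] using hy _ hk hkn _ hmono
  · have hlt (j : Fin l) : (c j.castSucc : ℕ) + 1 < n := by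
      have h1 : (c j.castSucc : ℕ) < c (Fin.last l) := hc (Fin.castSucc_lt_last j)
      have h2 := (c (Fin.last l)).isLt
      omega
    let d : Fin (l + 1) → Fin n :=
      Fin.cons ⟨0, (c 0).pos⟩ fun j => ⟨c j.castSucc + 1, hlt j⟩
    have hd : StrictMono d := by
      intro a b hab
      cases b using Fin.cases with
      | zero => exact absurd hab (Fin.not_lt_zero a)
      | succ b =>
        cases a using Fin.cases with
        | zero => exact Nat.succ_pos _
        | succ a =>
          exact Nat.succ_lt_succ (hc (Fin.castSucc_lt_castSucc_iff.2 (Fin.succ_lt_succ_iff.1 hab)))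
    have hl : Even l := by
      rcases Nat.even_or_odd l with hl | hl
      · exact hl
      · exact absurd hk (Nat.not_odd_iff_even.2 hl.add_one)
    have hsum : ∑ j : Fin (l + 1), ((-1 : ℝ) ^ (j : ℕ)) • tauMap Y n y (c j) =
        -∑ j : Fin (l + 1), ((-1 : ℝ) ^ (j : ℕ)) • y (d j) := by
      rw [Fin.sum_univ_castSucc, Fin.sum_univ_succ]
      simp [tauMap, hlt, h, d, hl.neg_one_pow, pow_succ, Finset.sum_neg_distrib, add_comm]
    rw [hsum, norm_neg]
    exact hy _ hk hkn d hd

lemma tauMap_iterate_apply {Y : Type*} [Neg Y] {n : ℕ} (y : Fin n → Y) {m : ℕ} (hm : m ≤ n)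
    (i : Fin n) : (tauMap Y n)^[m] y i =
      if h : (i : ℕ) + m < n then y ⟨i + m, h⟩ else -y ⟨i + m - n, by omega⟩ := by
  induction m generalizing i with
  | zero => simp
  | succ m ih =>
    rw [Function.iterate_succ_apply', tauMap]
    by_cases h : (i : ℕ) + 1 < n
    · rw [dif_pos h, ih (by omega)]
      simp only [add_assoc, add_comm 1 m]
    · have hi : (i : ℕ) + 1 = n := by omega
      rw [dif_neg h, ih (by omega), dif_pos (by simp; omega), dif_neg (by omega)]
      congr 3
      simp
      omega

lemma tauMap_iterate_self {Y : Type*} [Neg Y] {n : ℕ} (y : Fin n → Y) :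
    (tauMap Y n)^[n] y = -y := by
  funext i
  simp [tauMap_iterate_apply y le_rfl i]

lemma iterate_tauMap_mem_MSet {Y : Type*} [NormedAddCommGroup Y] [NormedSpace ℝ Y] {n : ℕ}
    (m : ℕ) {y : Fin n → Y} (hy : y ∈ MSet Y n) : (tauMap Y n)^[m] y ∈ MSet Y n := by
  induction m with
  | zero => exact hy
  | succ m ih =>
    rw [Function.iterate_succ_apply']
    exact tauMap_mem_MSet ih

lemma tauMap_mem_MSet_iff {Y : Type*} [NormedAddCommGroup Y] [NormedSpace ℝ Y] {n : ℕ}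
    (hn : 0 < n) {y : Fin n → Y} : tauMap Y n y ∈ MSet Y n ↔ y ∈ MSet Y n := by
  refine ⟨fun hy => ?_, tauMap_mem_MSet⟩
  have h := iterate_tauMap_mem_MSet (n - 1) hy
  rw [← Function.iterate_succ_apply, Nat.succ_eq_add_one, Nat.sub_add_cancel hn,
    tauMap_iterate_self] at h
  simpa only [neg_neg] using neg_mem_MSet h

/-- `(y₁,…,yₙ) ∈ M_Yⁿ` iff `τₙᵐ(y₁,…,yₙ) ∈ M_Yⁿ`, where
`τₙ(y₁,…,yₙ) = (y₂,…,yₙ,−y₁)`. -/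
theorem stmt4 (Y : Type*) [NormedAddCommGroup Y] [NormedSpace ℝ Y] [CompleteSpace Y]
    (n : ℕ) (hn : 0 < n) (m : ℕ) (hm : 0 < m) (y : Fin n → Y) :
    y ∈ MSet Y n ↔ (tauMap Y n)^[m] y ∈ MSet Y n := by
  clear hm
  induction m with
  | zero => rfl
  | succ m ih => rw [Function.iterate_succ_apply', tauMap_mem_MSet_iff hn, ih]
end
end

section
/- Let Y be a real Banach space, n a positive integer and B ⊆ S_{Y*} a 1-norming subset. The following are equivalent: (1) Y has the AHSp-ℓ∞ⁿ; (2) for every 0 < ε < 1 there is 0 < γ(ε) < ε such that for every (y₁,…,yₙ) ∈ M_Yⁿ, nonempty A ⊆ {1,…,n} and y* ∈ B with y*(yᵢ) > 1 − γ(ε) for each i ∈ A, there exists (z₁,…,zₙ) ∈ M_Yⁿ with ‖zᵢ − yᵢ‖ < ε for every i ≤ n and ‖∑_{i∈A} zᵢ‖ = |A|; (3) for every 0 < ε < 1 there is 0 < ρ(ε) < ε such that for every (y₁,…,yₙ) ∈ M_Yⁿ, if there exist n₀ ≤ n and y* ∈ B with y*(yᵢ) > 1 − ρ(ε) for each i ≤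 n₀, then there exists (z₁,…,zₙ) ∈ M_Yⁿ with ‖zᵢ − yᵢ‖ < ε for each i ≤ n and ‖∑_{i=1}^{n₀} zᵢ‖ = n₀; (4) for every 0 < ε < 1 there is 0 < ν(ε) < ε such that for each (y₁,…,yₙ) ∈ M_Yⁿ and each convex combination ∑_{i=1}^{n} αᵢyᵢ with ‖∑_{i=1}^{n} αᵢyᵢ‖ > 1 − ν(ε), there exist C ⊆ {1,…,n} and (z₁,…,zₙ) ∈ M_Yⁿ such that ∑_{i∈C} αᵢ > 1 − ε, ‖zᵢ − yᵢ‖ < ε for each i ≤ n, and ‖∑_{i∈C} zᵢ‖ = |C|. -/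
open scoped BigOperators

noncomputable section

theorem tauMap_of_lt {Y : Type*} [Neg Y] {n : ℕ} (y : Fin n → Y)
    {i : Fin n} (h : (i : ℕ) + 1 < n) :
    tauMap Y n y i = y ⟨(i : ℕ) + 1, h⟩ := dif_pos h

theorem tauMap_of_not_lt {Y : Type*} [Neg Y] {n : ℕ} (y : Fin n → Y)
    {i : Fin n} (h : ¬(i : ℕ) + 1 < n) :
    tauMap Y n y i = -y ⟨0, i.pos⟩ := dif_neg h

theorem norm_sub_lt_of_tauMap {Y : Type*} [NormedAddCommGroup Y] {n : ℕ}
    {w y : Fin n → Y} {ε : ℝ}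
    (h : ∀ i, ‖tauMap Y n w i - tauMap Y n y i‖ < ε) (i : Fin n) : ‖w i - y i‖ < ε := by
  obtain ⟨i, hi⟩ := i
  cases i with
  | zero =>
    have := h ⟨n - 1, by omega⟩
    rw [tauMap_of_not_lt _ (by simp; omega), tauMap_of_not_lt _ (by simp; omega), ← neg_sub',
      norm_neg] at this
    exact this
  | succ i =>
    have := h ⟨i, by omega⟩
    rwa [tauMap_of_lt _ hi, tauMap_of_lt _ hi] at this

section MSetLemmas

variable {Y : Type*} [NormedAddCommGroup Y] [NormedSpace ℝ Y] {n : ℕ}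

theorem MSet.neg_mem {y : Fin n → Y} (hy : y ∈ MSet Y n) : -y ∈ MSet Y n := by
  intro k hk hkn c hc
  have := hy k hk hkn c hc
  simpa [Finset.sum_neg_distrib, norm_neg] using this

theorem MSet.norm_le_one {y : Fin n → Y} (hy : y ∈ MSet Y n) (i : Fin n) : ‖y i‖ ≤ 1 := by
  have := hy 1 odd_one i.pos (fun _ => i) (Subsingleton.strictMono _)
  simpa using this

theorem MSet.norm_sub_add_le_one {y : Fin n → Y} (hy : y ∈ MSet Y n) {i j l : Fin n}
    (hij : i < j) (hjl : j < l) : ‖y i - y j + y l‖ ≤ 1 := by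
  have h3 : 3 ≤ n := by
    have := l.isLt
    rw [Fin.lt_def] at hij hjl
    omega
  have hc : StrictMono ![i, j, l] := by
    rw [Fin.strictMono_iff_lt_succ]
    intro a
    fin_cases a
    · exact hij
    · exact hjl
  have := hy 3 (by decide) h3 ![i, j, l] hc
  simpa [Fin.sum_univ_three, sub_eq_add_neg] using this

theorem MSet.comp_rev_mem {y : Fin n → Y} (hy : y ∈ MSet Y n) : y ∘ Fin.rev ∈ MSet Y n := by
  intro k hk hkn c hc
  have h := hy k hk hkn (fun j => (c j.rev).rev)
    (fun a b hab => Fin.rev_lt_rev.mpr (hc (Fin.rev_lt_rev.mpr hab)))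
  rw [← Equiv.sum_comp Fin.revPerm] at h
  convert h using 3 with j
  have hj : ((Fin.revPerm j : Fin k) : ℕ) + j = k - 1 := by
    have := j.isLt
    simp only [Fin.revPerm_apply, Fin.val_rev]
    omega
  have hpar : (-1 : ℝ) ^ ((Fin.revPerm j : Fin k) : ℕ) = (-1) ^ (j : ℕ) := by
    have he : Even (((Fin.revPerm j : Fin k) : ℕ) + j) := hj ▸ hk.tsub_odd odd_one
    rcases Nat.even_or_odd (j : ℕ) with h1 | h1
    · rw [h1.neg_one_pow, ((Nat.even_add.mp he).mpr h1).neg_one_pow]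
    · rw [h1.neg_one_pow, Odd.neg_one_pow]
      rw [← Nat.not_even_iff_odd] at h1 ⊢
      exact fun h2 => h1 ((Nat.even_add.mp he).mp h2)
  rw [hpar]
  simp

theorem MSet.tauMap_mem {y : Fin n → Y} (hy : y ∈ MSet Y n) : tauMap Y n y ∈ MSet Y n := by
  intro k hk hkn c hc
  obtain ⟨m, rfl⟩ : ∃ m, k = m + 1 := ⟨k - 1, by have := hk.pos; omega⟩
  have hm : Even m := by
    rcases Nat.even_or_odd m with h | h
    · exact h
    · exact absurd hk (by simpa using h.add_one)
  by_cases hl : (c (Fin.last m) : ℕ) + 1 < n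
  · have hlt (j) : (c j : ℕ) + 1 < n := by
      have := Fin.le_def.mp (hc.monotone (Fin.le_last j))
      omega
    have h := hy (m + 1) hk hkn (fun j => ⟨(c j : ℕ) + 1, hlt j⟩)
      (fun a b hab =>
        Fin.mk_lt_mk.mpr (Nat.add_lt_add_right (hc hab) 1))
    convert h using 4 with j
    exact tauMap_of_lt y (hlt j)
  · have hlt (j : Fin m) : (c j.castSucc : ℕ) + 1 < n := by
      have := Fin.lt_def.mp (hc (Fin.castSucc_lt_last j))
      have := (c (Fin.last m)).isLt
      omega
    have hn : 0 < n := (c 0).pos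
    have h := hy (m + 1) hk hkn
      (Fin.cons ⟨0, hn⟩ (fun j : Fin m => ⟨(c j.castSucc : ℕ) + 1, hlt j⟩))
      (by
        rw [Fin.strictMono_iff_lt_succ]
        intro a
        cases m with
        | zero => exact a.elim0
        | succ p =>
          cases a using Fin.cases with
          | zero => exact Fin.mk_lt_mk.mpr (Nat.succ_pos _)
          | succ b =>
            rw [← Fin.succ_castSucc, Fin.cons_succ, Fin.cons_succ]
            refine Fin.mk_lt_mk.mpr (Nat.add_lt_add_right (hc ?_) 1)
            exact Fin.castSucc_lt_castSucc_iff.mpr Fin.castSucc_lt_succ)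
    rw [← norm_neg]
    rw [Fin.sum_univ_succ] at h
    rw [Fin.sum_univ_castSucc]
    refine (congrArg norm ?_).trans_le h
    rw [neg_add, add_comm, ← Finset.sum_neg_distrib]
    congr 1
    · simp [hm.neg_one_pow, tauMap_of_not_lt y hl]
    · refine Finset.sum_congr rfl fun j _ => ?_
      simp [tauMap_of_lt y (hlt j), pow_succ]

theorem MSet.exists_tauMap_eq {z : Fin n → Y} (hz : z ∈ MSet Y n) :
    ∃ w ∈ MSet Y n, tauMap Y n w = z := by
  refine ⟨tauMap Y n (z ∘ Fin.rev) ∘ Fin.rev, MSet.comp_rev_mem (MSet.tauMap_mem (MSet.comp_rev_mem hz)), ?_⟩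
  funext i
  have hi := i.isLt
  by_cases h : (i : ℕ) + 1 < n
  · rw [tauMap_of_lt _ h, Function.comp_apply, tauMap_of_lt _ (by simp [Fin.val_rev]; omega)]
    simp only [Function.comp_apply]
    congr 1
    ext
    simp [Fin.val_rev]
    omega
  · rw [tauMap_of_not_lt _ h, Function.comp_apply,
      tauMap_of_not_lt _ (by simp [Fin.val_rev]; omega), neg_neg]
    simp only [Function.comp_apply]
    congr 1
    ext
    simp [Fin.val_rev]
    omega

theorem norm_sum_eq_card_iff_exists_dual {ι : Type*} {z : ι → Y} (hz : ∀ i, ‖z i‖ ≤ 1)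
    (A : Finset ι) :
    ‖∑ i ∈ A, z i‖ = (A.card : ℝ) ↔
      ∃ g : Y →L[ℝ] ℝ, ‖g‖ ≤ 1 ∧ ∀ i ∈ A, g (z i) = 1 := by
  constructor
  · intro h
    obtain ⟨g, hg, hgz⟩ := exists_dual_vector'' ℝ (∑ i ∈ A, z i)
    refine ⟨g, hg, ?_⟩
    have hle (i) : g (z i) ≤ 1 :=
      (le_abs_self _).trans ((g.le_of_opNorm_le_of_le hg (hz i)).trans_eq (one_mul 1))
    have hsum : ∑ i ∈ A, g (z i) = ∑ _i ∈ A, (1 : ℝ) := by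
      rw [← map_sum, hgz, h]
      simp
    exact (Finset.sum_eq_sum_iff_of_le fun i _ => hle i).mp hsum
  · rintro ⟨g, hg, hgz⟩
    refine le_antisymm ?_ ?_
    · refine (norm_sum_le_of_le A fun i _ => hz i).trans ?_
      simp
    · have h : g (∑ i ∈ A, z i) = (A.card : ℝ) := by
        rw [map_sum, Finset.sum_congr rfl hgz]
        simp
      rw [← h]
      exact (le_abs_self _).trans ((g.le_of_opNorm_le hg _).trans_eq (one_mul _))

theorem norm_sum_eq_card_of_subset {ι : Type*} {z : ι → Y} (hz : ∀ i, ‖z i‖ ≤ 1)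
    {A C : Finset ι} (hAC : A ⊆ C) (hC : ‖∑ i ∈ C, z i‖ = (C.card : ℝ)) :
    ‖∑ i ∈ A, z i‖ = (A.card : ℝ) := by
  rw [norm_sum_eq_card_iff_exists_dual hz] at hC ⊢
  obtain ⟨g, hg, h⟩ := hC
  exact ⟨g, hg, fun i hi => h i (hAC hi)⟩

/-- An approximation property for initial segments transfers to all intervals, by iterating
`tauMap`. -/
theorem exists_near_of_interval {f : Y →L[ℝ] ℝ} {ε ρ : ℝ}
    (H : ∀ y ∈ MSet Y n, ∀ n₀ : ℕ, 1 ≤ n₀ → n₀ ≤ n →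
      (∀ i : Fin n, (i : ℕ) < n₀ → 1 - ρ < f (y i)) →
        ∃ z ∈ MSet Y n, (∀ i, ‖z i - y i‖ < ε) ∧
          ‖∑ i ∈ Finset.univ.filter (fun i : Fin n => (i : ℕ) < n₀), z i‖ = (n₀ : ℝ))
    (a : ℕ) : ∀ b : ℕ, a < b → b ≤ n → ∀ y ∈ MSet Y n,
      (∀ i : Fin n, a ≤ (i : ℕ) → (i : ℕ) < b → 1 - ρ < f (y i)) →
        ∃ z ∈ MSet Y n, (∀ i, ‖z i - y i‖ < ε) ∧
          ∃ g : Y →L[ℝ] ℝ, ‖g‖ ≤ 1 ∧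
            ∀ i : Fin n, a ≤ (i : ℕ) → (i : ℕ) < b → g (z i) = 1 := by
  induction a with
  | zero =>
    intro b hb hbn y hy hfy
    obtain ⟨z, hz, hzy, hsum⟩ := H y hy b hb hbn fun i hi => hfy i (Nat.zero_le _) hi
    have hcard : (Finset.univ.filter (fun i : Fin n => (i : ℕ) < b)).card = b := by
      rw [Fin.card_filter_val_lt, min_eq_right hbn]
    replace hsum := hsum.trans (congrArg (Nat.cast : ℕ → ℝ) hcard.symm)
    rw [norm_sum_eq_card_iff_exists_dual (MSet.norm_le_one hz)] at hsum
    obtain ⟨g, hg, hgz⟩ := hsum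
    exact ⟨z, hz, hzy, g, hg, fun i _ hi => hgz i (by simpa using hi)⟩
  | succ a ih =>
    intro b hab hbn y hy hfy
    obtain ⟨z, hz, hzy, g, hg, hgz⟩ := ih (b - 1) (by omega) (by omega) _ (MSet.tauMap_mem hy)
      (fun i hi hib => by
        rw [tauMap_of_lt y (by omega)]
        exact hfy _ (by simpa using hi) (by simp; omega))
    obtain ⟨w, hw, rfl⟩ := MSet.exists_tauMap_eq hz
    refine ⟨w, hw, norm_sub_lt_of_tauMap hzy, g, hg, fun i hi hib => ?_⟩
    have := hgz ⟨i - 1, by omega⟩ (by simp; omega) (by simp; omega)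
    rw [tauMap_of_lt _ (by simp; omega)] at this
    convert this
    simp
    omega

theorem MSet.lt_apply_of_between {y : Fin n → Y} (hy : y ∈ MSet Y n) {f : Y →L[ℝ] ℝ}
    (hf : ‖f‖ ≤ 1) {γ : ℝ} (hγ : 0 < γ) {i j l : Fin n} (hi : 1 - γ < f (y i))
    (hl : 1 - γ < f (y l)) (hij : i ≤ j) (hjl : j ≤ l) : 1 - 2 * γ < f (y j) := by
  rcases hij.eq_or_lt with rfl | hij
  · linarith
  rcases hjl.eq_or_lt with rfl | hjl
  · linarith
  have h : f (y i - y j + y l) ≤ 1 :=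
    (le_abs_self _).trans
      ((f.le_of_opNorm_le_of_le hf (MSet.norm_sub_add_le_one hy hij hjl)).trans_eq (one_mul 1))
  rw [map_add, map_sub] at h
  linarith

theorem IsOneNorming.exists_lt_abs {B : Set (Y →L[ℝ] ℝ)} (hB : IsOneNorming B) {y : Y} {r : ℝ}
    (hr : 0 ≤ r) (h : r < ‖y‖) : ∃ f ∈ B, r < |f y| := by
  by_contra! hcon
  refine h.not_ge ?_
  rw [hB.2 y]
  refine Real.sSup_le ?_ hr
  rintro _ ⟨f, hf, rfl⟩
  exact hcon f hf

theorem one_sub_lt_sum_filter {ι : Type*} [Fintype ι] {α t : ι → ℝ} {γ ε : ℝ} (hγ : 0 < γ)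
    (hα : ∀ i, 0 ≤ α i) (hsum : ∑ i, α i = 1) (ht : ∀ i, t i ≤ 1)
    (h : 1 - γ * ε < ∑ i, α i * t i) :
    1 - ε < ∑ i ∈ Finset.univ.filter (fun i => 1 - γ < t i), α i := by
  have hle : ∑ i, α i * t i ≤
      ∑ i, ((1 - γ) * α i + γ * (if 1 - γ < t i then α i else 0)) := by
    refine Finset.sum_le_sum fun i _ => ?_
    have := hα i
    have := ht i
    split_ifs with hi
    · nlinarith
    · nlinarith
  rw [Finset.sum_add_distrib, ← Finset.mul_sum, ← Finset.mul_sum, hsum,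
    ← Finset.sum_filter] at hle
  by_contra! hcon
  nlinarith

end MSetLemmas

/-- for a 1-norming set `B ⊆ S_{Y*}`, the four conditions of
Proposition 2.6 are equivalent. Indices `i ≤ n₀` of the paper are the `i : Fin n`
with `(i : ℕ) < n₀` (0-indexed). -/
theorem stmt5 (Y : Type*) [NormedAddCommGroup Y] [NormedSpace ℝ Y] [CompleteSpace Y]
    (n : ℕ) (hn : 0 < n) (B : Set (Y →L[ℝ] ℝ)) (hB : IsOneNorming B) :
    List.TFAE
      [ -- 1) Y has the AHSp-ℓ∞ⁿ
        AHSp Y n,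
        -- 2) the AHSp condition holds for functionals in B
        (∀ ε : ℝ, 0 < ε → ε < 1 → ∃ γ : ℝ, 0 < γ ∧ γ < ε ∧
          ∀ y ∈ MSet Y n, ∀ A : Finset (Fin n), A.Nonempty →
            ∀ f ∈ B, (∀ i ∈ A, 1 - γ < f (y i)) →
              ∃ z ∈ MSet Y n, (∀ i, ‖z i - y i‖ < ε) ∧ ‖∑ i ∈ A, z i‖ = (A.card : ℝ)),
        -- 3) the condition for initial segments {1,…,n₀} and functionals in B
        (∀ ε : ℝ, 0 < ε → ε < 1 → ∃ ρ : ℝ, 0 < ρ ∧ ρ < ε ∧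
          ∀ y ∈ MSet Y n, ∀ n₀ : ℕ, 1 ≤ n₀ → n₀ ≤ n →
            ∀ f ∈ B, (∀ i : Fin n, (i : ℕ) < n₀ → 1 - ρ < f (y i)) →
              ∃ z ∈ MSet Y n, (∀ i, ‖z i - y i‖ < ε) ∧
                ‖∑ i ∈ Finset.univ.filter (fun i : Fin n => (i : ℕ) < n₀), z i‖ = (n₀ : ℝ)),
        -- 4) the convex-combination condition
        (∀ ε : ℝ, 0 < ε → ε < 1 → ∃ ν : ℝ, 0 < ν ∧ ν < ε ∧
          ∀ y ∈ MSet Y n, ∀ α : Fin n → ℝ, (∀ i, 0 ≤ α i) → (∑ i, α i) = 1 →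
            1 - ν < ‖∑ i, α i • y i‖ →
              ∃ C : Finset (Fin n), ∃ z ∈ MSet Y n,
                (1 - ε < ∑ i ∈ C, α i) ∧ (∀ i, ‖z i - y i‖ < ε) ∧
                ‖∑ i ∈ C, z i‖ = (C.card : ℝ)) ] := by
  tfae_have 1 → 2 := by
    intro h ε hε hε1
    obtain ⟨γ, hγ, hγε, H⟩ := h ε hε hε1
    exact ⟨γ, hγ, hγε, fun y hy A hA f hf => H y hy A hA f (hB.1 f hf)⟩
  tfae_have 2 → 3 := by
    intro h ε hε hε1
    obtain ⟨γ, hγ, hγε, H⟩ := h ε hε hε1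
    refine ⟨γ, hγ, hγε, fun y hy n₀ h1 hn₀ f hf hfy => ?_⟩
    obtain ⟨z, hz, hzy, hsum⟩ := H y hy (Finset.univ.filter (fun i : Fin n => (i : ℕ) < n₀))
      ⟨⟨0, hn⟩, by simpa using Nat.succ_le_iff.mp h1⟩ f hf (fun i hi => hfy i (by simpa using hi))
    refine ⟨z, hz, hzy, ?_⟩
    rw [hsum, Fin.card_filter_val_lt, min_eq_right hn₀]
  tfae_have 3 → 2 := by
    intro h ε hε hε1
    obtain ⟨ρ, hρ, hρε, H⟩ := h ε hε hε1
    refine ⟨ρ / 2, by linarith, by linarith, fun y hy A hA f hf hfy => ?_⟩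
    obtain ⟨z, hz, hzy, g, hg, hgz⟩ := exists_near_of_interval
      (fun y hy n₀ h1 hn₀ => H y hy n₀ h1 hn₀ f hf) (A.min' hA : ℕ) ((A.max' hA : ℕ) + 1)
      (Nat.lt_succ_of_le (Fin.le_def.mp (A.min'_le_max' hA))) (A.max' hA).isLt y hy
      (fun i hi hi' => by
        have := MSet.lt_apply_of_between hy (hB.1 f hf).le (half_pos hρ) (hfy _ (A.min'_mem hA))
          (hfy _ (A.max'_mem hA)) (Fin.le_def.mpr hi) (Fin.le_def.mpr (Nat.le_of_lt_succ hi'))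
        linarith)
    refine ⟨z, hz, hzy, (norm_sum_eq_card_iff_exists_dual (MSet.norm_le_one hz) A).mpr
      ⟨g, hg, fun i hi => hgz i (Fin.le_def.mp (A.min'_le i hi))
        (Nat.lt_succ_of_le (Fin.le_def.mp (A.le_max' i hi)))⟩⟩
  tfae_have 2 → 4 := by
    intro h ε hε hε1
    obtain ⟨γ, hγ, hγε, H⟩ := h ε hε hε1
    refine ⟨γ * ε, by positivity, by nlinarith, fun y hy α hα hsum hlt => ?_⟩
    obtain ⟨f, hf, hfy⟩ := hB.exists_lt_abs (by nlinarith) hlt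
    have key : ∀ x ∈ MSet Y n, 1 - γ * ε < f (∑ i, α i • x i) →
        ∃ C : Finset (Fin n), ∃ z ∈ MSet Y n,
          (1 - ε < ∑ i ∈ C, α i) ∧ (∀ i, ‖z i - x i‖ < ε) ∧
            ‖∑ i ∈ C, z i‖ = (C.card : ℝ) := by
      intro x hx hfx
      have hC : 1 - ε < ∑ i ∈ Finset.univ.filter (fun i => 1 - γ < f (x i)), α i := by
        refine one_sub_lt_sum_filter hγ hα hsum (fun i => ?_) (by simpa using hfx)
        exact (le_abs_self _).trans ((f.le_of_opNorm_le_of_le (hB.1 f hf).le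
          (MSet.norm_le_one hx i)).trans_eq (one_mul 1))
      have hne : (Finset.univ.filter (fun i => 1 - γ < f (x i))).Nonempty := by
        rw [Finset.nonempty_iff_ne_empty]
        intro h0
        rw [h0, Finset.sum_empty] at hC
        linarith
      obtain ⟨z, hz, hzx, hz'⟩ := H x hx _ hne f hf (fun i hi => by simpa using hi)
      exact ⟨_, z, hz, hC, hzx, hz'⟩
    rcases lt_abs.mp hfy with hpos | hneg
    · exact key y hy hpos
    · obtain ⟨C, z, hz, hC, hzy, hz'⟩ := key (-y) (MSet.neg_mem hy) (by simpa using hneg)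
      refine ⟨C, -z, MSet.neg_mem hz, hC, fun i => ?_, by simpa using hz'⟩
      rw [← norm_neg]
      simpa [add_comm, sub_eq_add_neg] using hzy i
  tfae_have 4 → 1 := by
    intro h ε hε hε1
    have hn1 : (1 : ℝ) ≤ n := by exact_mod_cast hn
    have hεn : ε / n ≤ ε := div_le_self hε.le hn1
    obtain ⟨ν, hν, hνε, H⟩ := h (ε / n) (by positivity) (by linarith)
    refine ⟨ν, hν, by linarith, fun y hy A hA f hf hfy => ?_⟩
    have hA0 : (0 : ℝ) < A.card := by exact_mod_cast hA.card_pos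
    have hAn : (A.card : ℝ) ≤ n := by
      exact_mod_cast (Finset.card_le_univ A).trans_eq (Fintype.card_fin n)
    have hsum : ∑ i, (if i ∈ A then (A.card : ℝ)⁻¹ else 0) = 1 := by
      simp [hA0.ne']
    obtain ⟨C, z, hz, hC, hzy, hz'⟩ := H y hy (fun i => if i ∈ A then (A.card : ℝ)⁻¹ else 0)
      (fun i => by positivity) hsum (by
        have h1 : f (∑ i, (if i ∈ A then (A.card : ℝ)⁻¹ else 0) • y i) ≤
            ‖∑ i, (if i ∈ A then (A.card : ℝ)⁻¹ else 0) • y i‖ :=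
          (le_abs_self _).trans ((f.le_of_opNorm_le hf.le _).trans_eq (one_mul _))
        refine lt_of_lt_of_le ?_ h1
        have h2 : f (∑ i, (if i ∈ A then (A.card : ℝ)⁻¹ else 0) • y i) =
            (A.card : ℝ)⁻¹ * ∑ i ∈ A, f (y i) := by
          simp [ite_smul, ← Finset.smul_sum, map_sum]
        have h3 : ∑ _i ∈ A, (1 - ν) < ∑ i ∈ A, f (y i) := Finset.sum_lt_sum_of_nonempty hA hfy
        rw [h2, ← div_eq_inv_mul, lt_div_iff₀ hA0]
        rwa [Finset.sum_const, nsmul_eq_mul, mul_comm] at h3)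
    have hAC : A ⊆ C := by
      intro i hi
      by_contra hiC
      have h1 : ∑ j ∈ insert i C, (if j ∈ A then (A.card : ℝ)⁻¹ else 0) ≤ 1 := by
        rw [← hsum]
        exact Finset.sum_le_sum_of_subset_of_nonneg (Finset.subset_univ _)
          fun j _ _ => by positivity
      rw [Finset.sum_insert hiC, if_pos hi] at h1
      have h2 : (n : ℝ)⁻¹ ≤ (A.card : ℝ)⁻¹ := inv_anti₀ hA0 hAn
      have h3 : ε / n ≤ (n : ℝ)⁻¹ := by
        rw [div_eq_mul_inv]
        exact mul_le_of_le_one_left (by positivity) hε1.le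
      linarith
    exact ⟨z, hz, fun i => (hzy i).trans_le hεn, norm_sum_eq_card_of_subset (MSet.norm_le_one hz) hAC hz'⟩
  tfae_finish
end
end

section
/- Let Y be a real Banach space and n a positive integer. Suppose Y has the AHSp-ℓ∞ⁿ with function γ : (0,1) → (0,1) (i.e. 0 < γ(ε) < ε and the AHSp condition holds with value γ(ε) for each ε). Then for every 0 < ε < 1 the following holds with ν(ε) = γ(ε)²: for each (y₁,…,yₙ) ∈ M_Yⁿ and each convex combination ∑_{i=1}^{n} αᵢyᵢ with ‖∑_{i=1}^{n} αᵢyᵢ‖ > 1 − ν(ε), there exist C ⊆ {1,…,n} and (z₁,…,zₙ) ∈ M_Yⁿ such that ∑_{i∈C} αᵢ > 1 − ε, ‖zᵢ − yᵢ‖ < ε for each i ≤ n, and ‖∑_{i∈C} zᵢ‖ = |C|. -/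
open scoped BigOperators

noncomputable section

theorem norm_apply_le_one_of_mem_MSet {Y : Type*} [NormedAddCommGroup Y] [NormedSpace ℝ Y]
    {n : ℕ} {y : Fin n → Y} (hy : y ∈ MSet Y n) (i : Fin n) : ‖y i‖ ≤ 1 := by
  simpa using hy 1 odd_one i.pos (fun _ => i) (Subsingleton.strictMono _)

/-- A weighted Markov inequality: if a convex combination of numbers `t i ≤ 1` exceeds `1 - r ^ 2`,
then the indices with `t i > 1 - r` carry more than `1 - r` of the total weight. -/
theorem one_sub_lt_sum_filter_of_one_sub_sq_lt {ι : Type*} [Fintype ι] {α t : ι → ℝ} {r : ℝ}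
    (hr : 0 < r) (hα : ∀ i, 0 ≤ α i) (hsum : ∑ i, α i = 1) (ht : ∀ i, t i ≤ 1)
    (h : 1 - r ^ 2 < ∑ i, α i * t i) :
    1 - r < ∑ i with 1 - r < t i, α i := by
  have hle : ∑ i, α i * t i ≤ ∑ i, ((1 - r) * α i + r * if 1 - r < t i then α i else 0) := by
    refine Finset.sum_le_sum fun i _ => ?_
    split_ifs with hi
    · nlinarith [hα i, ht i]
    · nlinarith [hα i]
  rw [Finset.sum_add_distrib, ← Finset.mul_sum, ← Finset.mul_sum, hsum, ← Finset.sum_filter] at hle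
  nlinarith

/-- if `Y` has the AHSp-ℓ∞ⁿ with function `γ`, then condition 4) of
Proposition 2.6 holds with `ν(ε) = γ(ε)²`. -/
theorem stmt6 (Y : Type*) [NormedAddCommGroup Y] [NormedSpace ℝ Y] [CompleteSpace Y]
    (n : ℕ) (hn : 0 < n) (γ : ℝ → ℝ) (hγ : AHSpWith Y n γ) :
    ∀ ε : ℝ, 0 < ε → ε < 1 →
      ∀ y ∈ MSet Y n, ∀ α : Fin n → ℝ, (∀ i, 0 ≤ α i) → (∑ i, α i) = 1 →
        1 - (γ ε) ^ 2 < ‖∑ i, α i • y i‖ →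
          ∃ C : Finset (Fin n), ∃ z ∈ MSet Y n,
            (1 - ε < ∑ i ∈ C, α i) ∧ (∀ i, ‖z i - y i‖ < ε) ∧
            ‖∑ i ∈ C, z i‖ = (C.card : ℝ) := by
  intro ε hε hε1 y hy α hα hsum hnorm
  obtain ⟨⟨hγ0, hγε⟩, hA⟩ := hγ ε hε hε1
  have hpos : 0 < ‖∑ i, α i • y i‖ := by nlinarith
  obtain ⟨f, hf, hfw⟩ := exists_dual_vector ℝ (∑ i, α i • y i) hpos.ne'
  replace hfw : ∑ i, α i * f (y i) = ‖∑ i, α i • y i‖ := by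
    simpa using hfw
  have hfy (i : Fin n) : f (y i) ≤ 1 := by
    calc f (y i) ≤ ‖f (y i)‖ := Real.le_norm_self _
      _ ≤ ‖f‖ * ‖y i‖ := f.le_opNorm _
      _ ≤ 1 := by rw [hf, one_mul]; exact norm_apply_le_one_of_mem_MSet hy i
  have hC := one_sub_lt_sum_filter_of_one_sub_sq_lt hγ0 hα hsum hfy (hfw ▸ hnorm)
  have hne : ({i | 1 - γ ε < f (y i)} : Finset (Fin n)).Nonempty := by
    rw [Finset.nonempty_iff_ne_empty]
    intro hempty
    rw [hempty, Finset.sum_empty] at hC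
    linarith
  obtain ⟨z, hz, hzy, hzC⟩ := hA y hy _ hne f hf fun i hi => (Finset.mem_filter.mp hi).2
  exact ⟨_, z, hz, by linarith, hzy, hzC⟩
end
end

section
/- Let Y be a real Banach space and n a positive integer. If Y has the approximate hyperplane sum property for ℓ∞ⁿ⁺¹, then Y has the approximate hyperplane sum property for ℓ∞ⁿ. -/
open scoped BigOperators

noncomputable section

/-- Repeating the last entry of a tuple in `MSet Y n` yields a tuple in `MSet Y (n + 1)`. -/
theorem comp_min_mem_MSet {Y : Type*} [NormedAddCommGroup Y] [NormedSpace ℝ Y] {n : ℕ}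
    (hn : 0 < n) {y : Fin n → Y} (hy : y ∈ MSet Y n) :
    (fun i : Fin (n + 1) => y ⟨min (i : ℕ) (n - 1), by omega⟩) ∈ MSet Y (n + 1) := by
  intro k hk hkn c hc
  set p : Fin (n + 1) → Fin n := fun i => ⟨min (i : ℕ) (n - 1), by omega⟩
  change ‖∑ j : Fin k, ((-1 : ℝ) ^ (j : ℕ)) • y (p (c j))‖ ≤ 1
  by_cases hmono : StrictMono (p ∘ c)
  · have hcard := Fintype.card_le_of_injective _ hmono.injective
    simp only [Fintype.card_fin] at hcard
    exact hy k hk hcard (p ∘ c) hmono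
  · obtain ⟨i, j, hij, hle⟩ : ∃ i j, i < j ∧ p (c j) ≤ p (c i) := by
      simpa [StrictMono] using hmono
    obtain ⟨m, rfl⟩ : ∃ m, k = m + 2 := ⟨k - 2, by omega⟩
    have hcij : (c i : ℕ) < c j := hc hij
    have hle' : min (c j : ℕ) (n - 1) ≤ min (c i : ℕ) (n - 1) := hle
    have hlast : (c j : ℕ) ≤ c (Fin.last (m + 1)) := hc.monotone (Fin.le_last j)
    have hprev : (c i : ℕ) ≤ c (Fin.last m).castSucc :=
      hc.monotone (by rw [Fin.le_def]; simp; omega)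
    have heq : p (c (Fin.last (m + 1))) = p (c (Fin.last m).castSucc) := by
      rw [Fin.ext_iff]
      change min (c (Fin.last (m + 1)) : ℕ) (n - 1) =
        min (c (Fin.last m).castSucc : ℕ) (n - 1)
      omega
    have hm : Odd m := by
      rw [Nat.odd_iff] at hk ⊢
      omega
    have hinit : StrictMono fun l : Fin m => p (c l.castSucc.castSucc) := by
      intro a b hab
      have h₁ : (c a.castSucc.castSucc : ℕ) < c b.castSucc.castSucc := hc (by simpa using hab)
      have h₂ : (c b.castSucc.castSucc : ℕ) < c (Fin.last m).castSucc :=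
        hc (by rw [Fin.lt_def]; simp)
      have h₃ : (c (Fin.last m).castSucc : ℕ) < c (Fin.last (m + 1)) :=
        hc (by rw [Fin.lt_def]; simp)
      have h₄ := (c (Fin.last (m + 1))).isLt
      change min (c a.castSucc.castSucc : ℕ) (n - 1) < min (c b.castSucc.castSucc : ℕ) (n - 1)
      omega
    rw [Fin.sum_univ_castSucc, Fin.sum_univ_castSucc, heq]
    simpa [pow_succ, add_assoc] using hy m hm (by omega) _ hinit

/-- Dropping the last entry of a tuple in `MSet Y (n + 1)` yields a tuple in `MSet Y n`. -/
theorem comp_castSucc_mem_MSet {Y : Type*} [NormedAddCommGroup Y] [NormedSpace ℝ Y] {n : ℕ}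
    {z : Fin (n + 1) → Y} (hz : z ∈ MSet Y (n + 1)) :
    (fun i : Fin n => z i.castSucc) ∈ MSet Y n :=
  fun k hk hkn c hc => hz k hk (by omega) (fun j => (c j).castSucc)
    (Fin.strictMono_castSucc.comp hc)

/-- the AHSp-ℓ∞ⁿ⁺¹ implies the AHSp-ℓ∞ⁿ. -/
theorem stmt9 (Y : Type*) [NormedAddCommGroup Y] [NormedSpace ℝ Y] [CompleteSpace Y]
    (n : ℕ) (hn : 0 < n) (h : AHSp Y (n + 1)) : AHSp Y n := by
  intro ε hε hε1
  obtain ⟨γ, hγ, hγε, H⟩ := h ε hε hε1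
  refine ⟨γ, hγ, hγε, fun y hy A hA f hf hfA => ?_⟩
  have hext (i : Fin n) : (⟨min (i.castSucc : ℕ) (n - 1), by omega⟩ : Fin n) = i := by
    rw [Fin.ext_iff]
    simp only [Fin.val_castSucc]
    omega
  obtain ⟨z, hz, hzy, hzA⟩ := H _ (comp_min_mem_MSet hn hy) (A.map Fin.castSuccEmb)
    (hA.map) f hf (by
      intro i hi
      obtain ⟨a, ha, rfl⟩ := Finset.mem_map.1 hi
      simpa only [Fin.coe_castSuccEmb, hext] using hfA a ha)
  refine ⟨fun i => z i.castSucc, comp_castSucc_mem_MSet hz, fun i => ?_, ?_⟩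
  · simpa only [hext] using hzy i.castSucc
  · simpa using hzA
end
end

section
/- If (y₁,…,yₙ) ∈ M_Yⁿ and one defines zᵢ = yᵢ for i ≤ n and z_{n+1} = yₙ, then (z₁,…,z_{n+1}) ∈ M_Yⁿ⁺¹. -/
open scoped BigOperators

noncomputable section

/-- if `(y₁,…,yₙ) ∈ M_Yⁿ`, then `(y₁,…,yₙ,yₙ) ∈ M_Yⁿ⁺¹`
(0-indexed: `z i = y i` for `i < n` and `z n = y (n−1)`). -/
theorem stmt10 (Y : Type*) [NormedAddCommGroup Y] [NormedSpace ℝ Y] [CompleteSpace Y]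
    (n : ℕ) (hn : 0 < n) (y : Fin n → Y) (hy : y ∈ MSet Y n) :
    (fun i : Fin (n + 1) =>
      if h : (i : ℕ) < n then y ⟨(i : ℕ), h⟩ else y ⟨n - 1, by omega⟩) ∈ MSet Y (n + 1) := by
  intro k hk hkn c hc
  set p : Fin (n + 1) → Fin n := fun i => ⟨min (i : ℕ) (n - 1), by omega⟩
  have hz : ∀ i : Fin (n + 1),
      (if h : (i : ℕ) < n then y ⟨(i : ℕ), h⟩ else y ⟨n - 1, by omega⟩) = y (p i) := by
    intro i
    have := i.isLt
    split_ifs with h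
    · exact congrArg y (Fin.ext (show (i : ℕ) = min (i : ℕ) (n - 1) by omega))
    · exact congrArg y (Fin.ext (show n - 1 = min (i : ℕ) (n - 1) by omega))
  simp only [hz]
  by_cases hpc : StrictMono (p ∘ c)
  · have hle : k ≤ n := by
      simpa using Fintype.card_le_of_injective _ hpc.injective
    exact hy k hk hle (p ∘ c) hpc
  · simp only [StrictMono, not_forall] at hpc
    obtain ⟨a, b, hab, hnot⟩ := hpc
    have hcab : (c a : ℕ) < c b := hc hab
    have hnot' : min (c b : ℕ) (n - 1) ≤ min (c a : ℕ) (n - 1) := not_lt.mp hnot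
    have hcb := (c b).isLt
    have hab' : (a : ℕ) < b := hab
    have hbk := b.isLt
    obtain ⟨m, rfl⟩ : ∃ m, k = m + 2 := ⟨k - 2, by omega⟩
    have hblast : (c b : ℕ) ≤ c (Fin.last (m + 1)) := hc.monotone (Fin.le_last b)
    have hasecond : (c a : ℕ) ≤ c (Fin.last m).castSucc :=
      hc.monotone (show (a : ℕ) ≤ m by omega)
    have hpp : p (c (Fin.last m).castSucc) = p (c (Fin.last (m + 1))) :=
      Fin.ext (show min (c (Fin.last m).castSucc : ℕ) (n - 1)
        = min (c (Fin.last (m + 1)) : ℕ) (n - 1) by omega)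
    rw [Fin.sum_univ_castSucc, Fin.sum_univ_castSucc, hpp, add_assoc, ← add_smul]
    simp only [Fin.val_castSucc, Fin.val_last, pow_succ, mul_neg, mul_one, add_neg_cancel,
      zero_smul, add_zero]
    refine hy m (by grind) (by omega) (fun j => p (c j.castSucc.castSucc)) fun i j hij => ?_
    have h₁ : (c i.castSucc.castSucc : ℕ) < c j.castSucc.castSucc := hc hij
    have h₂ : (c j.castSucc.castSucc : ℕ) < c (Fin.last m).castSucc := hc j.isLt
    have h₃ : (c (Fin.last m).castSucc : ℕ) < c (Fin.last (m + 1)) := hc (Nat.lt_succ_self m)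
    have h₄ := (c (Fin.last (m + 1))).isLt
    exact show min (c i.castSucc.castSucc : ℕ) (n - 1) < min (c j.castSucc.castSucc : ℕ) (n - 1)
      by omega
end
end

section
/- Let Y be a real Banach space, n a positive integer, S ∈ L(ℓ∞ⁿ, Y) with ‖S‖ = 1, and y ∈ S_{ℓ∞ⁿ} with ‖S(y)‖ = 1. If i₀ ≤ n satisfies |y(i₀)| < 1 and t ∈ [−1,1], then the element y′ ∈ S_{ℓ∞ⁿ} defined by y′(i) = y(i) for i ≠ i₀ and y′(i₀) = t satisfies ‖S(y′)‖ = 1. -/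
open scoped BigOperators

noncomputable section

/-- Replacing a coordinate by a number in `[-1, 1]` keeps a vector in the unit ball. -/
theorem norm_update_le_one {ι : Type*} [Fintype ι] [DecidableEq ι] {y : ι → ℝ} (hy : ‖y‖ ≤ 1)
    (i₀ : ι) {t : ℝ} (ht : |t| ≤ 1) : ‖Function.update y i₀ t‖ ≤ 1 := by
  refine (pi_norm_le_iff_of_nonneg zero_le_one).2 fun i => ?_
  rcases eq_or_ne i i₀ with rfl | h
  · simpa using ht
  · simpa [h] using (norm_le_pi_norm y i).trans hy

/-- if a norm-one operator `S` on `ℓ∞ⁿ` attains its norm at `y ∈ S_{ℓ∞ⁿ}` and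
`|y(i₀)| < 1`, then for any `t ∈ [−1,1]` the vector obtained by replacing the `i₀`-th
coordinate of `y` by `t` lies in `S_{ℓ∞ⁿ}` and `S` also attains its norm there. -/
theorem stmt11 (n : ℕ) (hn : 0 < n) (Y : Type*) [NormedAddCommGroup Y] [NormedSpace ℝ Y]
    [CompleteSpace Y] (S : (Fin n → ℝ) →L[ℝ] Y) (hS : ‖S‖ = 1)
    (y : Fin n → ℝ) (hy : ‖y‖ = 1) (hSy : ‖S y‖ = 1)
    (i₀ : Fin n) (hi₀ : |y i₀| < 1) (t : ℝ) (ht : t ∈ Set.Icc (-1 : ℝ) 1) :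
    ‖Function.update y i₀ t‖ = 1 ∧ ‖S (Function.update y i₀ t)‖ = 1 := by
  have hball : ∀ r : ℝ, |r| ≤ 1 → ‖S (Function.update y i₀ r)‖ ≤ 1 := fun r hr =>
    (S.le_of_opNorm_le_of_le hS.le (norm_update_le_one hy.le i₀ hr)).trans (one_mul _).le
  have ht' : |t| ≤ 1 := abs_le.2 ht
  set δ := (1 - |y i₀|) / 2 with hδ
  have hδ_pos : 0 < δ := by linarith
  set r := y i₀ - δ * (t - y i₀) with hr
  have hr_le : |r| ≤ 1 := by
    have hdist : |t - y i₀| ≤ 2 := (abs_sub t (y i₀)).trans (by linarith)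
    calc |r| ≤ |y i₀| + |δ * (t - y i₀)| := abs_sub _ _
      _ = |y i₀| + δ * |t - y i₀| := by rw [abs_mul, abs_of_pos hδ_pos]
      _ ≤ |y i₀| + δ * 2 := by gcongr
      _ = 1 := by rw [hδ]; ring
  have hcomb : (1 + δ) • y = Function.update y i₀ r + δ • Function.update y i₀ t := by
    ext i
    rcases eq_or_ne i i₀ with rfl | h
    · simp only [Pi.smul_apply, Pi.add_apply, Function.update_self, smul_eq_mul, hr]
      ring
    · simp only [Pi.smul_apply, Pi.add_apply, Function.update_of_ne h, smul_eq_mul]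
      ring
  have hlower : 1 + δ ≤ 1 + δ * ‖S (Function.update y i₀ t)‖ :=
    calc 1 + δ = ‖S ((1 + δ) • y)‖ := by
          rw [map_smul, norm_smul, hSy, mul_one, Real.norm_of_nonneg (by linarith)]
      _ ≤ ‖S (Function.update y i₀ r)‖ + ‖δ • S (Function.update y i₀ t)‖ := by
          rw [hcomb, map_add, map_smul]
          exact norm_add_le _ _
      _ ≤ 1 + δ * ‖S (Function.update y i₀ t)‖ := by
          rw [norm_smul, Real.norm_of_nonneg hδ_pos.le]
          gcongr
          exact hball r hr_le
  have hS_one : ‖S (Function.update y i₀ t)‖ = 1 :=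
    le_antisymm (hball t ht') (by nlinarith)
  refine ⟨le_antisymm (norm_update_le_one hy.le i₀ ht') ?_, hS_one⟩
  simpa [hS, hS_one] using S.le_opNorm (Function.update y i₀ t)
end
end

section
/- Let n be a positive integer, ε > 0, and let x, y ∈ co(𝓑ₙ) with x = ∑_{i=1}^{n} αᵢ vᵢⁿ and y = ∑_{i=1}^{n} βᵢ vᵢⁿ. If ‖x − y‖ < ε, then max{|αᵢ − βᵢ| : 1 ≤ i ≤ n} < ε. -/
open scoped BigOperators

noncomputable section

/-- Each coordinate functional with respect to the `vvec n k` is half a signed sum of two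
evaluations. -/
theorem exists_two_ite_eq_vvec (n : ℕ) (i : Fin n) :
    ∃ p q : Fin n, ∃ s t : ℝ, |s| = 1 ∧ |t| = 1 ∧
      ∀ k : Fin n, 2 * (if k = i then (1 : ℝ) else 0) = s * vvec n k p + t * vvec n k q := by
  obtain ⟨p, hp⟩ : ∃ p : Fin n, ∀ k : Fin n,
      vvec n k p = if i < k then -1 else 1 := by
    by_cases hi : (i : ℕ) + 1 < n
    · refine ⟨⟨i + 1, hi⟩, fun k => ?_⟩
      simp [vvec]
    · refine ⟨⟨0, i.pos⟩, fun k => ?_⟩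
      have : ¬ i < k := by have := k.isLt; rw [Fin.lt_def]; omega
      simp [vvec, this]
  by_cases h0 : (i : ℕ) = 0
  · refine ⟨p, i, 1, 1, by simp, by simp, fun k => ?_⟩
    rw [hp]
    simp only [vvec, Fin.lt_def, Fin.ext_iff]
    split_ifs <;> first | omega | norm_num
  · refine ⟨p, i, 1, -1, by simp, by simp, fun k => ?_⟩
    rw [hp]
    simp only [vvec, Fin.lt_def, Fin.ext_iff]
    split_ifs <;> first | omega | norm_num

theorem abs_le_norm_sum_smul_vvec (n : ℕ) (δ : Fin n → ℝ) (i : Fin n) :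
    |δ i| ≤ ‖∑ k, δ k • vvec n k‖ := by
  obtain ⟨p, q, s, t, hs, ht, hpq⟩ := exists_two_ite_eq_vvec n i
  set w := ∑ k, δ k • vvec n k with hw
  have hδ : 2 * δ i = s * w p + t * w q := by
    calc 2 * δ i = ∑ k, δ k * (2 * (if k = i then (1 : ℝ) else 0)) := by simp [mul_comm]
      _ = ∑ k, (s * (δ k * vvec n k p) + t * (δ k * vvec n k q)) :=
        Finset.sum_congr rfl fun k _ => by rw [hpq]; ring
      _ = s * w p + t * w q := by
        simp [hw, Finset.sum_add_distrib, Finset.mul_sum, Finset.sum_apply]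
  have h2 : 2 * |δ i| ≤ |w p| + |w q| := by
    calc 2 * |δ i| = |s * w p + t * w q| := by rw [← hδ, abs_mul, abs_two]
      _ ≤ |s * w p| + |t * w q| := abs_add_le _ _
      _ = |w p| + |w q| := by rw [abs_mul, abs_mul, hs, ht, one_mul, one_mul]
  have hp : |w p| ≤ ‖w‖ := norm_le_pi_norm w p
  have hq : |w q| ≤ ‖w‖ := norm_le_pi_norm w q
  linarith

/-- Lemma 3.2: if `x = ∑ αᵢ vᵢⁿ` and `y = ∑ βᵢ vᵢⁿ` belong to `co(𝓑ₙ)` and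
`‖x − y‖ < ε`, then `|αᵢ − βᵢ| < ε` for every `i`. -/
theorem stmt13 (n : ℕ) (hn : 0 < n) (ε : ℝ) (hε : 0 < ε) (α β : Fin n → ℝ)
    (hx : (∑ i, α i • vvec n i) ∈ convexHull ℝ (Set.range (vvec n)))
    (hy : (∑ i, β i • vvec n i) ∈ convexHull ℝ (Set.range (vvec n)))
    (h : ‖(∑ i, α i • vvec n i) - ∑ i, β i • vvec n i‖ < ε) :
    ∀ i, |α i - β i| < ε := by
  intro i
  have hsub : (∑ i, α i • vvec n i) - ∑ i, β i • vvec n i = ∑ i, (α i - β i) • vvec n i := by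
    simp only [sub_smul, Finset.sum_sub_distrib]
  rw [hsub] at h
  exact (abs_le_norm_sum_smul_vvec n (fun i => α i - β i) i).trans_lt h
end
end
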